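/- arXiv:2203.09731 — 2 statements merged into one kernel-verified Lean document; each statement's English description precedes it below -/
import Mathlib

section
/- The function y ↦ log|y| · (1 − |y|²)/(1 + |y|²)³ is integrable on ℝ² with respect to Lebesgue measure and ∫_{ℝ²} log|y| · (1 − |y|²)/(1 + |y|²)³ dy = −π/2. -/
open MeasureTheory Real

/-- An antiderivative on `(0, ∞)` of the radial density `r log r (1 - r²) / (1 + r²)³`. -/
noncomputable def radialPrimitive (r : ℝ) : ℝ :=
  r * Real.log r * (r / (2 * (1 + r ^ 2) ^ 2)) + 1 / (4 * (1 + r ^ 2))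

theorem continuous_radialPrimitive : Continuous radialPrimitive := by
  unfold radialPrimitive
  refine (Real.continuous_mul_log.mul ?_).add ?_
  · exact continuous_id.div (by fun_prop) fun r => by positivity
  · exact continuous_const.div (by fun_prop) fun r => by positivity

theorem hasDerivAt_radialPrimitive {r : ℝ} (hr : 0 < r) :
    HasDerivAt radialPrimitive
      (r * (Real.log r * ((1 - r ^ 2) / (1 + r ^ 2) ^ 3))) r := by
  have hq : HasDerivAt (fun x : ℝ => 1 + x ^ 2) (2 * r) r := by
    simpa using (hasDerivAt_pow 2 r).const_add 1
  have hd : 1 + r ^ 2 ≠ 0 := by positivity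
  have h := (((hasDerivAt_id r).mul (Real.hasDerivAt_log hr.ne')).mul
    ((hasDerivAt_id r).div ((hq.pow 2).const_mul 2) (by simpa using hd))).add
    ((hasDerivAt_const r (1 : ℝ)).div (hq.const_mul 4) (by simpa using hd))
  refine h.congr_deriv ?_
  simp only [id, Pi.mul_apply, Pi.div_apply, Pi.pow_apply]
  field_simp
  ring

theorem tendsto_radialPrimitive_atTop :
    Filter.Tendsto radialPrimitive Filter.atTop (nhds 0) := by
  have h2 : Filter.Tendsto (fun r : ℝ => 2 * r⁻¹) Filter.atTop (nhds 0) := by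
    simpa using tendsto_inv_atTop_zero.const_mul (2 : ℝ)
  refine squeeze_zero' ?_ ?_ h2 <;>
    filter_upwards [Filter.eventually_ge_atTop (1 : ℝ)] with r hr <;>
    have hr0 : 0 < r := by linarith
  · have := Real.log_nonneg hr
    unfold radialPrimitive
    positivity
  · have hlog : Real.log r ≤ r := (Real.log_le_sub_one_of_pos hr0).trans (by linarith)
    have h1 : r * Real.log r * (r / (2 * (1 + r ^ 2) ^ 2)) ≤ r⁻¹ := by
      calc r * Real.log r * (r / (2 * (1 + r ^ 2) ^ 2))
          ≤ r * r * (r / (2 * (1 + r ^ 2) ^ 2)) := by gcongr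
        _ ≤ r⁻¹ := by
          rw [← mul_div_assoc, inv_eq_one_div, div_le_div_iff₀ (by positivity) hr0]
          nlinarith [sq_nonneg r, sq_nonneg (r ^ 2)]
    have h3 : 1 / (4 * (1 + r ^ 2)) ≤ r⁻¹ := by
      rw [inv_eq_one_div]
      exact one_div_le_one_div_of_le hr0 (by nlinarith)
    unfold radialPrimitive
    linarith

theorem mul_log_mul_one_sub_sq_div_cube_nonpos {r : ℝ} (hr : 0 < r) :
    r * (Real.log r * ((1 - r ^ 2) / (1 + r ^ 2) ^ 3)) ≤ 0 := by
  refine mul_nonpos_of_nonneg_of_nonpos hr.le ?_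
  rcases le_total r 1 with h | h
  · exact mul_nonpos_of_nonpos_of_nonneg (Real.log_nonpos hr.le h)
      (div_nonneg (by nlinarith) (by positivity))
  · exact mul_nonpos_of_nonneg_of_nonpos (Real.log_nonneg h)
      (div_nonpos_of_nonpos_of_nonneg (by nlinarith) (by positivity))

theorem integral_log_mul_one_sub_sq_div_cube :
    Integrable (fun y : EuclideanSpace ℝ (Fin 2) =>
        Real.log ‖y‖ * ((1 - ‖y‖ ^ 2) / (1 + ‖y‖ ^ 2) ^ 3)) volume ∧
      ∫ y : EuclideanSpace ℝ (Fin 2),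
          Real.log ‖y‖ * ((1 - ‖y‖ ^ 2) / (1 + ‖y‖ ^ 2) ^ 3) = -(π / 2) := by
  have hcont := continuous_radialPrimitive.continuousWithinAt (s := Set.Ici 0) (x := 0)
  constructor
  · rw [integrable_fun_norm_addHaar volume
      (f := fun r : ℝ => Real.log r * ((1 - r ^ 2) / (1 + r ^ 2) ^ 3))]
    simpa using integrableOn_Ioi_deriv_of_nonpos hcont (fun _ => hasDerivAt_radialPrimitive)
      (fun _ => mul_log_mul_one_sub_sq_div_cube_nonpos) tendsto_radialPrimitive_atTop
  · have hint := integral_Ioi_of_hasDerivAt_of_nonpos hcont (fun _ => hasDerivAt_radialPrimitive)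
      (fun _ => mul_log_mul_one_sub_sq_div_cube_nonpos) tendsto_radialPrimitive_atTop
    rw [integral_fun_norm_addHaar volume
      (fun r : ℝ => Real.log r * ((1 - r ^ 2) / (1 + r ^ 2) ^ 3))]
    have hball : volume.real (Metric.ball (0 : EuclideanSpace ℝ (Fin 2)) 1) = π := by
      simp [measureReal_def, EuclideanSpace.volume_ball_fin_two, Real.pi_nonneg]
    rw [hball]
    simp only [finrank_euclideanSpace, Fintype.card_fin, Nat.add_one_sub_one, pow_one,
      smul_eq_mul, nsmul_eq_mul, hint]
    simp [radialPrimitive]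
    ring
end

section
/- Let f : ℝ² → ℝ be twice continuously differentiable with compact support. Then lim_{δ → 0⁺} ( ∫_{ℝ²} f(y) · 8δ²/(δ² + |y|²)³ dy − 4π f(0)/δ² ) = π Δf(0), where Δ denotes the Euclidean Laplacian Δf = ∂²f/∂y₁² + ∂²f/∂y₂². -/
open MeasureTheory Real Filter

/-- Euclidean Laplacian on ℝ²: sum of second partial derivatives. -/
noncomputable def lap (f : EuclideanSpace ℝ (Fin 2) → ℝ) (x : EuclideanSpace ℝ (Fin 2)) : ℝ :=
  ∑ i : Fin 2,
    fderiv ℝ (fun y => fderiv ℝ f y (EuclideanSpace.single i (1 : ℝ))) x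
      (EuclideanSpace.single i (1 : ℝ))

open Topology in
/-- Symmetric second differences of a `C²` function converge to its second derivative. -/
lemma tendsto_second_difference {E : Type*} [NormedAddCommGroup E] [NormedSpace ℝ E]
    {f : E → ℝ} (hf : ContDiff ℝ 2 f) (z : E) :
    Tendsto (fun t : ℝ => (f (t • z) + f (-(t • z)) - 2 * f 0) / t ^ 2) (𝓝[>] 0)
      (𝓝 (fderiv ℝ (fderiv ℝ f) 0 z z)) := by
  have hd : Differentiable ℝ f := hf.differentiable (by norm_num)
  have hd2 : Differentiable ℝ (fderiv ℝ f) :=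
    (hf.fderiv_right (m := 1) (by norm_num)).differentiable (by norm_num)
  have hline (t : ℝ) : HasDerivAt (fun s : ℝ => s • z) z t := by
    simpa using (hasDerivAt_id t).smul_const z
  have h1 (t : ℝ) : HasDerivAt (fun t : ℝ => f (t • z) + f (-(t • z)) - 2 * f 0)
      (fderiv ℝ f (t • z) z - fderiv ℝ f (-(t • z)) z) t := by
    have ha := (hd (t • z)).hasFDerivAt.comp_hasDerivAt t (hline t)
    have hb := (hd (-(t • z))).hasFDerivAt.comp_hasDerivAt t (hline t).fun_neg
    simpa [Function.comp_def, sub_eq_add_neg] using (ha.fun_add hb).sub_const (2 * f 0)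
  have h2 (t : ℝ) : HasDerivAt (fun t : ℝ => t ^ 2) (2 * t) t := by
    simpa using hasDerivAt_pow 2 t
  have h3 : HasDerivAt (fun t : ℝ => fderiv ℝ f (t • z) z - fderiv ℝ f (-(t • z)) z)
      (2 * fderiv ℝ (fderiv ℝ f) 0 z z) 0 := by
    have hz : HasFDerivAt (fderiv ℝ f) (fderiv ℝ (fderiv ℝ f) 0) ((0 : ℝ) • z) := by
      simpa using (hd2 0).hasFDerivAt
    have hk : HasDerivAt (fun t : ℝ => fderiv ℝ f (t • z) z)
        (fderiv ℝ (fderiv ℝ f) 0 z z) 0 :=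
      (ContinuousLinearMap.apply ℝ ℝ z).hasFDerivAt.comp_hasDerivAt 0
        (hz.comp_hasDerivAt 0 (hline 0))
    have hk' : HasDerivAt (fun t : ℝ => fderiv ℝ f (t • z) z)
        (fderiv ℝ (fderiv ℝ f) 0 z z) (-0) := by rwa [neg_zero]
    have hb := hk'.comp (0 : ℝ) (hasDerivAt_neg (0 : ℝ))
    have hfun : (fun t : ℝ => fderiv ℝ f (t • z) z - fderiv ℝ f (-(t • z)) z) =
        fun t => fderiv ℝ f (t • z) z - ((fun t => fderiv ℝ f (t • z) z) ∘ Neg.neg) t := by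
      ext t
      simp
    rw [hfun]
    exact (hk.fun_sub hb).congr_deriv (by ring)
  refine HasDerivAt.lhopital_zero_nhdsGT (.of_forall h1) (.of_forall h2) ?_ ?_ ?_ ?_
  · filter_upwards [self_mem_nhdsWithin] with t ht
    exact mul_ne_zero two_ne_zero (ne_of_gt ht)
  · have := (h1 0).continuousAt.tendsto
    simp only [zero_smul, neg_zero, ← two_mul, sub_self] at this
    exact this.mono_left nhdsWithin_le_nhds
  · have := (h2 0).continuousAt.tendsto
    simp only [ne_eq, OfNat.ofNat_ne_zero, not_false_eq_true, zero_pow] at this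
    exact this.mono_left nhdsWithin_le_nhds
  · have := h3.tendsto_slope_zero_right.const_mul (1 / 2)
    refine (this.congr fun t => ?_).trans_eq ?_
    · simp [div_eq_mul_inv]; ring
    · congr 1; ring

/-- The symmetric second difference of a compactly supported `C²` function at the origin is
bounded by a multiple of the squared norm of the increment. -/
lemma exists_abs_second_difference_le {E : Type*} [NormedAddCommGroup E] [NormedSpace ℝ E]
    {f : E → ℝ} (hf : ContDiff ℝ 2 f) (hsupp : HasCompactSupport f) :
    ∃ C : ℝ, ∀ z, |f z + f (-z) - 2 * f 0| ≤ C * ‖z‖ ^ 2 := by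
  have hd : Differentiable ℝ f := hf.differentiable (by norm_num)
  obtain ⟨L, hL⟩ := ContDiff.lipschitzWith_of_hasCompactSupport (hsupp.fderiv ℝ)
    (hf.fderiv_right (m := 1) (by norm_num)) (by norm_num)
  refine ⟨2 * L, fun z => ?_⟩
  have hline (t : ℝ) : HasDerivAt (fun s : ℝ => s • z) z t := by
    simpa using (hasDerivAt_id t).smul_const z
  have h1 (t : ℝ) : HasDerivAt (fun t : ℝ => f (t • z) + f (-(t • z)))
      (fderiv ℝ f (t • z) z - fderiv ℝ f (-(t • z)) z) t := by
    have ha := (hd (t • z)).hasFDerivAt.comp_hasDerivAt t (hline t)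
    have hb := (hd (-(t • z))).hasFDerivAt.comp_hasDerivAt t (hline t).fun_neg
    simpa [Function.comp_def, sub_eq_add_neg] using ha.fun_add hb
  have h2 (t : ℝ) (ht : t ∈ Set.Ico (0 : ℝ) 1) :
      ‖fderiv ℝ f (t • z) z - fderiv ℝ f (-(t • z)) z‖ ≤ 2 * L * ‖z‖ ^ 2 := by
    rw [← sub_apply]
    refine (ContinuousLinearMap.le_opNorm _ _).trans ?_
    have hn : ‖t • z - -(t • z)‖ ≤ 2 * ‖z‖ := by
      rw [sub_neg_eq_add, ← two_smul ℝ, norm_smul, norm_smul, Real.norm_of_nonneg ht.1,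
        Real.norm_of_nonneg zero_le_two]
      nlinarith [norm_nonneg z, ht.2]
    have := (hL.norm_sub_le (t • z) (-(t • z))).trans (mul_le_mul_of_nonneg_left hn L.2)
    calc _ ≤ (L * (2 * ‖z‖)) * ‖z‖ := mul_le_mul_of_nonneg_right this (norm_nonneg z)
      _ = _ := by ring
  have := norm_image_sub_le_of_norm_deriv_le_segment' (a := 0) (b := 1)
    (fun t _ => (h1 t).hasDerivWithinAt) h2 1 (by simp)
  simpa [← two_mul] using this

/-- Integration of a nonnegative radial function on the plane from a radial primitive. -/
lemma integral_radial_plane {φ G : ℝ → ℝ} {l : ℝ} (hφ : ∀ r, 0 ≤ φ r)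
    (hG : ∀ r, HasDerivAt G (r * φ r) r) (hl : Tendsto G atTop (nhds l)) :
    Integrable (fun y : EuclideanSpace ℝ (Fin 2) => φ ‖y‖) ∧
      ∫ y : EuclideanSpace ℝ (Fin 2), φ ‖y‖ = 2 * π * (l - G 0) := by
  have hpos : ∀ r ∈ Set.Ioi (0 : ℝ), 0 ≤ r * φ r := fun r hr => mul_nonneg (le_of_lt hr) (hφ r)
  constructor
  · rw [integrable_fun_norm_addHaar (f := φ) volume]
    simpa using integrableOn_Ioi_deriv_of_nonneg' (fun r _ => hG r) hpos hl
  · rw [integral_fun_norm_addHaar volume φ]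
    have := integral_Ioi_of_hasDerivAt_of_nonneg' (fun r _ => hG r) hpos hl
    simp [this, Measure.real, EuclideanSpace.volume_ball_fin_two, pi_pos.le]
    ring

lemma tendsto_inv_one_add_sq_atTop :
    Tendsto (fun r : ℝ => (1 + r ^ 2)⁻¹) atTop (nhds 0) :=
  (tendsto_atTop_add_const_left _ _ (tendsto_pow_atTop two_ne_zero)).inv_tendsto_atTop

/-- The total mass of the kernel `8 / (1 + |y|²)³` on the plane. -/
lemma integral_kernel :
    Integrable (fun y : EuclideanSpace ℝ (Fin 2) => 8 / (1 + ‖y‖ ^ 2) ^ 3) ∧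
      ∫ y : EuclideanSpace ℝ (Fin 2), 8 / (1 + ‖y‖ ^ 2) ^ 3 = 4 * π := by
  have hl : Tendsto (fun r : ℝ => -2 * ((1 + r ^ 2)⁻¹) ^ 2) atTop (nhds 0) := by
    simpa using (tendsto_inv_one_add_sq_atTop.pow 2).const_mul (-2)
  have := integral_radial_plane (φ := fun r => 8 / (1 + r ^ 2) ^ 3) (fun r => by positivity)
    (fun r => ?_) hl
  · refine ⟨this.1, this.2.trans ?_⟩
    norm_num
    ring
  · have h0 : 1 + r ^ 2 ≠ 0 := by positivity
    refine ((((hasDerivAt_pow 2 r).const_add 1).fun_inv h0).fun_pow 2).const_mul (-2)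
      |>.congr_deriv ?_
    simp only [Nat.cast_ofNat, Nat.add_one_sub_one, pow_one]
    field_simp
    ring

/-- The second moment of the kernel `8 / (1 + |y|²)³` on the plane. -/
lemma integral_sq_mul_kernel :
    Integrable (fun y : EuclideanSpace ℝ (Fin 2) => ‖y‖ ^ 2 * (8 / (1 + ‖y‖ ^ 2) ^ 3)) ∧
      ∫ y : EuclideanSpace ℝ (Fin 2), ‖y‖ ^ 2 * (8 / (1 + ‖y‖ ^ 2) ^ 3) = 4 * π := by
  have hl : Tendsto (fun r : ℝ => 2 * (1 - (1 + r ^ 2)⁻¹) ^ 2) atTop (nhds 2) := by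
    simpa using ((tendsto_inv_one_add_sq_atTop.const_sub 1).pow 2).const_mul 2
  have := integral_radial_plane (φ := fun r => r ^ 2 * (8 / (1 + r ^ 2) ^ 3))
    (fun r => by positivity) (fun r => ?_) hl
  · refine ⟨this.1, this.2.trans ?_⟩
    norm_num
    ring
  · have h0 : 1 + r ^ 2 ≠ 0 := by positivity
    refine (((((hasDerivAt_pow 2 r).const_add 1).fun_inv h0).const_sub 1).fun_pow 2).const_mul 2
      |>.congr_deriv ?_
    simp only [Nat.cast_ofNat, Nat.add_one_sub_one, pow_one]
    field_simp
    ring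

/-- Rotation of the plane by a right angle. -/
noncomputable def quarterTurn : EuclideanSpace ℝ (Fin 2) ≃ₗᵢ[ℝ] EuclideanSpace ℝ (Fin 2) where
  toFun z := !₂[-z 1, z 0]
  invFun z := !₂[z 1, -z 0]
  map_add' x y := by ext i; fin_cases i <;> simp [add_comm]
  map_smul' c x := by ext i; fin_cases i <;> simp
  left_inv x := by ext i; fin_cases i <;> simp
  right_inv x := by ext i; fin_cases i <;> simp
  norm_map' x := by simp [EuclideanSpace.norm_eq, add_comm]

lemma bilinear_add_quarterTurn
    (B : EuclideanSpace ℝ (Fin 2) →L[ℝ] EuclideanSpace ℝ (Fin 2) →L[ℝ] ℝ)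
    (z : EuclideanSpace ℝ (Fin 2)) :
    B z z + B (quarterTurn z) (quarterTurn z) =
      (∑ i, B (EuclideanSpace.single i 1) (EuclideanSpace.single i 1)) * ‖z‖ ^ 2 := by
  have hz (x : EuclideanSpace ℝ (Fin 2)) :
      x = x 0 • EuclideanSpace.single 0 1 + x 1 • EuclideanSpace.single 1 1 := by
    ext i; fin_cases i <;> simp
  have h0 : quarterTurn z 0 = -z 1 := rfl
  have h1 : quarterTurn z 1 = z 0 := rfl
  have hn : ‖z‖ ^ 2 = z 0 ^ 2 + z 1 ^ 2 := by simp [EuclideanSpace.norm_sq_eq]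
  rw [hz (quarterTurn z), h0, h1, hn]
  conv_lhs => rw [hz z]
  simp
  ring

/-- Integral of a quadratic form against the kernel `8 / (1 + |y|²)³`. -/
lemma integral_bilinear_mul_kernel
    (B : EuclideanSpace ℝ (Fin 2) →L[ℝ] EuclideanSpace ℝ (Fin 2) →L[ℝ] ℝ) :
    ∫ z, B z z * (8 / (1 + ‖z‖ ^ 2) ^ 3) =
      2 * π * ∑ i, B (EuclideanSpace.single i 1) (EuclideanSpace.single i 1) := by
  have hint : Integrable (fun z => B z z * (8 / (1 + ‖z‖ ^ 2) ^ 3)) := by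
    refine (integral_sq_mul_kernel.1.const_mul ‖B‖).mono' ?_ (.of_forall fun z => ?_)
    · refine Continuous.aestronglyMeasurable ?_
      refine Continuous.mul (by fun_prop) (continuous_const.div (by fun_prop) fun z => ?_)
      positivity
    · rw [norm_mul, Real.norm_of_nonneg (by positivity : 0 ≤ 8 / (1 + ‖z‖ ^ 2) ^ 3), ← mul_assoc]
      gcongr
      exact (B.le_opNorm₂ z z).trans_eq (by ring)
  have hmp := quarterTurn.measurePreserving
  have hemb := quarterTurn.toHomeomorph.measurableEmbedding
  have hrot := hmp.integral_comp hemb (fun z => B z z * (8 / (1 + ‖z‖ ^ 2) ^ 3))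
  have hint' := (hmp.integrable_comp_emb hemb).2 hint
  have hadd := integral_add hint hint'
  simp only [Function.comp_apply, LinearIsometryEquiv.norm_map, ← add_mul,
    bilinear_add_quarterTurn, mul_assoc] at hadd hrot
  rw [integral_const_mul, integral_sq_mul_kernel.2, hrot] at hadd
  linarith

/-- Rescaling the kernel to unit width. -/
lemma integral_mul_scaled_kernel (f : EuclideanSpace ℝ (Fin 2) → ℝ) {δ : ℝ} (hδ : 0 < δ) :
    ∫ y : EuclideanSpace ℝ (Fin 2), f y * (8 * δ ^ 2 / (δ ^ 2 + ‖y‖ ^ 2) ^ 3) =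
      (∫ z : EuclideanSpace ℝ (Fin 2), f (δ • z) * (8 / (1 + ‖z‖ ^ 2) ^ 3)) / δ ^ 2 := by
  have h := Measure.integral_comp_smul volume
    (fun y : EuclideanSpace ℝ (Fin 2) => f y * (8 * δ ^ 2 / (δ ^ 2 + ‖y‖ ^ 2) ^ 3)) δ
  have hk (z : EuclideanSpace ℝ (Fin 2)) :
      f (δ • z) * (8 * δ ^ 2 / (δ ^ 2 + ‖δ • z‖ ^ 2) ^ 3) =
        (δ ^ 4)⁻¹ * (f (δ • z) * (8 / (1 + ‖z‖ ^ 2) ^ 3)) := by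
    rw [norm_smul, Real.norm_of_nonneg hδ.le,
      show δ ^ 2 + (δ * ‖z‖) ^ 2 = δ ^ 2 * (1 + ‖z‖ ^ 2) by ring]
    field_simp
  simp only [hk, integral_const_mul, finrank_euclideanSpace, Fintype.card_fin, smul_eq_mul] at h
  rw [abs_of_nonneg (by positivity)] at h
  rw [eq_div_iff (by positivity), mul_comm]
  rw [inv_mul_eq_iff_eq_mul₀ (by positivity)] at h
  rw [h, ← mul_assoc]
  congr 1
  field_simp

/-- The defect of the kernel average as an integral of symmetric second differences. -/
lemma integral_second_difference_mul_kernel {f : EuclideanSpace ℝ (Fin 2) → ℝ}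
    (hf : Continuous f) (hsupp : HasCompactSupport f) {δ : ℝ} (hδ : 0 < δ) :
    (∫ y : EuclideanSpace ℝ (Fin 2), f y * (8 * δ ^ 2 / (δ ^ 2 + ‖y‖ ^ 2) ^ 3)) -
        4 * π * f 0 / δ ^ 2 =
      1 / 2 * ∫ z : EuclideanSpace ℝ (Fin 2),
        (f (δ • z) + f (-(δ • z)) - 2 * f 0) / δ ^ 2 * (8 / (1 + ‖z‖ ^ 2) ^ 3) := by
  obtain ⟨M, hM⟩ := hsupp.exists_bound_of_continuous hf
  have hint : Integrable (fun z => f (δ • z) * (8 / (1 + ‖z‖ ^ 2) ^ 3)) :=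
    integral_kernel.1.bdd_mul (by fun_prop) (.of_forall fun z => hM _)
  have hneg := integral_neg_eq_self (fun z => f (δ • z) * (8 / (1 + ‖z‖ ^ 2) ^ 3)) volume
  have hint' := hint.comp_neg
  simp only [smul_neg, norm_neg] at hneg hint'
  have hsplit (z : EuclideanSpace ℝ (Fin 2)) :
      (f (δ • z) + f (-(δ • z)) - 2 * f 0) / δ ^ 2 * (8 / (1 + ‖z‖ ^ 2) ^ 3) =
        (δ ^ 2)⁻¹ * (f (δ • z) * (8 / (1 + ‖z‖ ^ 2) ^ 3) +
          f (-(δ • z)) * (8 / (1 + ‖z‖ ^ 2) ^ 3) - 2 * f 0 * (8 / (1 + ‖z‖ ^ 2) ^ 3)) := by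
    ring
  simp only [hsplit]
  rw [integral_const_mul, integral_sub (hint.fun_add hint') (integral_kernel.1.const_mul _),
    integral_add hint hint', integral_const_mul, integral_kernel.2, hneg,
    integral_mul_scaled_kernel f hδ]
  ring

lemma lap_eq_sum_fderiv_fderiv {f : EuclideanSpace ℝ (Fin 2) → ℝ} (hf : ContDiff ℝ 2 f)
    (x : EuclideanSpace ℝ (Fin 2)) :
    lap f x = ∑ i, fderiv ℝ (fderiv ℝ f) x (EuclideanSpace.single i 1)
      (EuclideanSpace.single i 1) := by
  have hd2 : Differentiable ℝ (fderiv ℝ f) :=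
    (hf.fderiv_right (m := 1) (by norm_num)).differentiable (by norm_num)
  refine Finset.sum_congr rfl fun i _ => ?_
  rw [fderiv_clm_apply (hd2 x) (differentiableAt_const _)]
  simp

theorem second_order_expansion (f : EuclideanSpace ℝ (Fin 2) → ℝ)
    (hf : ContDiff ℝ 2 f) (hsupp : HasCompactSupport f) :
    Tendsto (fun δ : ℝ =>
        (∫ y : EuclideanSpace ℝ (Fin 2), f y * (8 * δ ^ 2 / (δ ^ 2 + ‖y‖ ^ 2) ^ 3)) -
          4 * π * f 0 / δ ^ 2)
      (nhdsWithin 0 (Set.Ioi 0)) (nhds (π * lap f 0)) := by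
  obtain ⟨C, hC⟩ := exists_abs_second_difference_le hf hsupp
  have hlim : π * lap f 0 = 1 / 2 * ∫ z : EuclideanSpace ℝ (Fin 2),
      fderiv ℝ (fderiv ℝ f) 0 z z * (8 / (1 + ‖z‖ ^ 2) ^ 3) := by
    rw [integral_bilinear_mul_kernel, lap_eq_sum_fderiv_fderiv hf]
    ring
  have hcont := hf.continuous
  rw [hlim]
  refine Tendsto.congr' (eventually_nhdsWithin_of_forall fun δ hδ =>
    (integral_second_difference_mul_kernel hcont hsupp hδ).symm) (Tendsto.const_mul _ ?_)
  refine tendsto_integral_filter_of_dominated_convergence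
    (fun z => C * (‖z‖ ^ 2 * (8 / (1 + ‖z‖ ^ 2) ^ 3))) ?_ ?_
    (integral_sq_mul_kernel.1.const_mul C) ?_
  · refine .of_forall fun δ => Continuous.aestronglyMeasurable ?_
    refine Continuous.mul (by fun_prop) (continuous_const.div (by fun_prop) fun z => ?_)
    positivity
  · refine eventually_nhdsWithin_of_forall fun δ (hδ : 0 < δ) => .of_forall fun z => ?_
    rw [norm_mul, Real.norm_of_nonneg (by positivity : 0 ≤ 8 / (1 + ‖z‖ ^ 2) ^ 3), ← mul_assoc]
    gcongr
    rw [norm_div, Real.norm_of_nonneg (sq_nonneg δ), div_le_iff₀ (by positivity)]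
    refine (hC (δ • z)).trans_eq ?_
    rw [norm_smul, Real.norm_of_nonneg hδ.le]
    ring
  · exact .of_forall fun z => (tendsto_second_difference hf z).mul_const _
end
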